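/- arXiv:1107.5859 — 5 statements merged into one kernel-verified Lean document; each statement's English description precedes it below -/
import Mathlib

section
/- Let α ∈ (0, 1) and let f, g : ℝ → ℂ be Schwartz functions. Then ∫_ℝ ∫_ℝ f(x) \overline{g(y)} |x−y|^{−α} dy dx = (π^{α−1/2} Γ((1−α)/2) / Γ(α/2)) ∫_ℝ f̃(ω) \overline{g̃(ω)} |ω|^{α−1} dω, where f̃(ω) = ∫_ℝ e^{−2πiωx} f(x) dx is the Fourier transform. -/
open MeasureTheory Real FourierTransform

/-- The singularity of `|u| ^ β` at the origin is integrable when `-1 < β ≤ 0`, and `|u| ^ β` is at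
most `1` away from it. -/
theorem exists_integrable_abs_rpow_le {β : ℝ} (hβ : -1 < β) (hβ0 : β ≤ 0) :
    ∃ h : ℝ → ℝ, Integrable h ∧ ∀ u, |u| ^ β ≤ 1 + h u := by
  set k : ℝ → ℝ := (Set.Ioc (0 : ℝ) 1).indicator fun x ↦ x ^ β with hk
  have hki : Integrable k := by
    refine IntegrableOn.integrable_indicator ?_ measurableSet_Ioc
    rw [← intervalIntegrable_iff_integrableOn_Ioc_of_le zero_le_one]
    exact intervalIntegral.intervalIntegrable_rpow' hβ
  have hk0 : ∀ u, 0 ≤ k u := fun u ↦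
    Set.indicator_nonneg (fun x hx ↦ Real.rpow_nonneg hx.1.le _) u
  refine ⟨fun u ↦ k u + k (-u), hki.add hki.comp_neg, fun u ↦ ?_⟩
  have h1 := hk0 u
  have h2 := hk0 (-u)
  rcases eq_or_ne u 0 with rfl | hu
  · have : |(0 : ℝ)| ^ β ≤ 1 := by simpa using Real.zero_rpow_le_one β
    linarith
  rcases le_total 1 |u| with h | h
  · have := Real.rpow_le_one_of_one_le_of_nonpos h hβ0
    linarith
  rcases lt_or_gt_of_ne hu with hneg | hpos
  · have : k (-u) = |u| ^ β := by
      rw [abs_of_neg hneg] at h ⊢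
      exact Set.indicator_of_mem (Set.mem_Ioc.2 ⟨by linarith, h⟩) _
    linarith
  · have : k u = |u| ^ β := by
      rw [abs_of_pos hpos] at h ⊢
      exact Set.indicator_of_mem (Set.mem_Ioc.2 ⟨hpos, h⟩) _
    linarith

theorem integrable_mul_abs_rpow {F : ℝ → ℂ} {C β : ℝ} (hF : Integrable F) (hC : ∀ x, ‖F x‖ ≤ C)
    (hβ : -1 < β) (hβ0 : β ≤ 0) : Integrable fun x ↦ F x * ((|x| ^ β : ℝ) : ℂ) := by
  obtain ⟨h, hh, hle⟩ := exists_integrable_abs_rpow_le hβ hβ0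
  refine (hF.norm.add (hh.norm.const_mul C)).mono'
    (hF.aestronglyMeasurable.mul
      (Complex.measurable_ofReal.comp (by fun_prop)).aestronglyMeasurable) (.of_forall fun x ↦ ?_)
  have h0 : 0 ≤ |x| ^ β := by positivity
  have h1 : |x| ^ β ≤ 1 + ‖h x‖ := (hle x).trans (by gcongr; exact Real.le_norm_self _)
  rw [norm_mul, Complex.norm_real, Real.norm_of_nonneg h0]
  calc ‖F x‖ * |x| ^ β ≤ ‖F x‖ * (1 + ‖h x‖) := by gcongr
    _ = ‖F x‖ + ‖F x‖ * ‖h x‖ := by ring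
    _ ≤ ‖F x‖ + C * ‖h x‖ := by gcongr; exact hC x

theorem integrable_prod_mul_abs_sub_rpow {f g : ℝ → ℂ} {C β : ℝ} (hf : Integrable f)
    (hC : ∀ x, ‖f x‖ ≤ C) (hg : Integrable g) (hβ : -1 < β) (hβ0 : β ≤ 0) :
    Integrable fun p : ℝ × ℝ ↦ f p.1 * g p.2 * ((|p.1 - p.2| ^ β : ℝ) : ℂ) := by
  obtain ⟨h, hh, hle⟩ := exists_integrable_abs_rpow_le hβ hβ0
  have hconv : Integrable (fun p : ℝ × ℝ ↦ g p.2 * (h (p.1 - p.2) : ℂ)) :=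
    hg.convolution_integrand (ContinuousLinearMap.mul ℂ ℂ) (hh.ofReal (𝕜 := ℂ))
  have hfg : Integrable (fun p : ℝ × ℝ ↦ f p.1 * g p.2) := hf.mul_prod hg
  refine (hfg.norm.add (hconv.norm.const_mul C)).mono'
    (hfg.aestronglyMeasurable.mul
      (Complex.measurable_ofReal.comp (by fun_prop)).aestronglyMeasurable) (.of_forall fun p ↦ ?_)
  have h0 : 0 ≤ |p.1 - p.2| ^ β := by positivity
  have h1 : |p.1 - p.2| ^ β ≤ 1 + ‖h (p.1 - p.2)‖ :=
    (hle _).trans (by gcongr; exact Real.le_norm_self _)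
  simp only [norm_mul, Complex.norm_real, Real.norm_of_nonneg h0, Pi.add_apply]
  calc ‖f p.1‖ * ‖g p.2‖ * |p.1 - p.2| ^ β
      ≤ ‖f p.1‖ * ‖g p.2‖ * (1 + ‖h (p.1 - p.2)‖) := by gcongr
    _ = ‖f p.1‖ * ‖g p.2‖ + ‖f p.1‖ * (‖g p.2‖ * ‖h (p.1 - p.2)‖) := by ring
    _ ≤ ‖f p.1‖ * ‖g p.2‖ + C * (‖g p.2‖ * ‖h (p.1 - p.2)‖) := by gcongr; exact hC _

theorem integral_mul_ofReal_const_mul {X : Type*} [MeasurableSpace X] {μ : Measure X} (F : X → ℂ)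
    (c : ℝ) (φ : X → ℝ) :
    ∫ x, F x * ((c * φ x : ℝ) : ℂ) ∂μ = (c : ℂ) * ∫ x, F x * (φ x : ℂ) ∂μ := by
  rw [← integral_const_mul]
  congr 1
  ext x
  push_cast
  ring

/-- Fubini for a kernel written as a superposition `K x = ∫ φ x t dt` of nonnegative kernels. -/
theorem integral_mul_eq_integral_integral_of_kernel {X T : Type*} [MeasurableSpace X]
    [MeasurableSpace T] {μ : Measure X} {ν : Measure T} [SFinite μ] [SFinite ν]
    {F : X → ℂ} {φ : X → T → ℝ} {K : X → ℝ} (hF : AEStronglyMeasurable F μ)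
    (hφ : Measurable (Function.uncurry φ)) (hφ0 : ∀ x, ∀ᵐ t ∂ν, 0 ≤ φ x t)
    (hK : ∀ᵐ x ∂μ, ∫ t, φ x t ∂ν = K x) (hK0 : ∀ᵐ x ∂μ, K x ≠ 0)
    (hFK : Integrable (fun x ↦ F x * (K x : ℂ)) μ) :
    ∫ x, F x * (K x : ℂ) ∂μ = ∫ t, ∫ x, F x * (φ x t : ℂ) ∂μ ∂ν := by
  have hint : Integrable (Function.uncurry fun x t ↦ F x * (φ x t : ℂ)) (μ.prod ν) := by
    refine (integrable_prod_iff ?_).2 ⟨?_, ?_⟩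
    · exact (hF.comp_fst (ν := ν)).mul (Complex.measurable_ofReal.comp hφ).aestronglyMeasurable
    · filter_upwards [hK, hK0] with x hx hx0
      have : Integrable (φ x) ν := .of_integral_ne_zero (by rwa [hx])
      exact (this.ofReal (𝕜 := ℂ)).const_mul (F x)
    · refine hFK.norm.congr ?_
      filter_upwards [hK, hK0] with x hx hx0
      have hKnn : 0 ≤ K x := hx ▸ integral_nonneg_of_ae (hφ0 x)
      have : ∫ t, ‖F x * (φ x t : ℂ)‖ ∂ν = ∫ t, ‖F x‖ * φ x t ∂ν := by
        refine integral_congr_ae ?_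
        filter_upwards [hφ0 x] with t ht
        rw [norm_mul, Complex.norm_real, Real.norm_of_nonneg ht]
      simp only [Function.uncurry_apply_pair]
      rw [this, integral_const_mul, hx, norm_mul, Complex.norm_real, Real.norm_of_nonneg hKnn]
  rw [← integral_integral_swap hint]
  refine integral_congr_ae ?_
  filter_upwards [hK] with x hx
  rw [integral_const_mul, integral_complex_ofReal, hx]

theorem exp_neg_pi_mul_sq_mul_eq_integral {t : ℝ} (ht : 0 < t) (u : ℝ) :
    ((rexp (-(π * u ^ 2 * t)) : ℝ) : ℂ) = ((t ^ (-(1 / 2) : ℝ) : ℝ) : ℂ) *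
      ∫ ω : ℝ, Complex.exp (((-2 * π * ω * u : ℝ) : ℂ) * Complex.I) *
        ((rexp (-(π * ω ^ 2 / t)) : ℝ) : ℂ) := by
  have hb : 0 < (((1 / t : ℝ)) : ℂ).re := by simpa using ht
  have key := congrFun (fourier_gaussian_pi hb) u
  rw [fourier_real_eq_integral_exp_smul] at key
  have hpow : (((1 / t : ℝ)) : ℂ) ^ (1 / 2 : ℂ) = ((t ^ (-(1 / 2) : ℝ) : ℝ) : ℂ) := by
    rw [show (1 / 2 : ℂ) = ((1 / 2 : ℝ) : ℂ) by norm_num, ← Complex.ofReal_cpow (by positivity),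
      one_div, Real.inv_rpow ht.le, Real.rpow_neg ht.le]
  have hne : ((t ^ (-(1 / 2) : ℝ) : ℝ) : ℂ) ≠ 0 := by
    exact_mod_cast (Real.rpow_pos_of_pos ht _).ne'
  have hl : (∫ ω : ℝ, Complex.exp (((-2 * π * ω * u : ℝ) : ℂ) * Complex.I) *
        ((rexp (-(π * ω ^ 2 / t)) : ℝ) : ℂ)) =
      1 / ((t ^ (-(1 / 2) : ℝ) : ℝ) : ℂ) * ((rexp (-(π * u ^ 2 * t)) : ℝ) : ℂ) := by
    have ht0 : (t : ℂ) ≠ 0 := by exact_mod_cast ht.ne'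
    rw [← hpow]
    refine (integral_congr_ae (.of_forall fun ω ↦ ?_)).trans (key.trans ?_)
    · simp only [smul_eq_mul, Complex.ofReal_exp]
      congr 2
      push_cast
      ring
    · rw [Complex.ofReal_exp]
      congr 2
      push_cast
      field_simp
  rw [hl]
  field_simp

theorem integral_prod_mul_exp_neg_pi_sq_sub {f g : ℝ → ℂ} (hf : Integrable f) (hg : Integrable g)
    {t : ℝ} (ht : 0 < t) :
    ∫ p : ℝ × ℝ, f p.1 * (starRingEnd ℂ) (g p.2) *
        ((rexp (-(π * (p.1 - p.2) ^ 2 * t)) : ℝ) : ℂ) =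
      ((t ^ (-(1 / 2) : ℝ) : ℝ) : ℂ) * ∫ ω : ℝ, 𝓕 f ω * (starRingEnd ℂ) (𝓕 g ω) *
        ((rexp (-(π * ω ^ 2 / t)) : ℝ) : ℂ) := by
  have hgc : Integrable fun y ↦ (starRingEnd ℂ) (g y) :=
    (Complex.conjLIE.integrable_comp_iff (φ := g)).2 hg
  have hfg : Integrable (fun p : ℝ × ℝ ↦ f p.1 * (starRingEnd ℂ) (g p.2)) := hf.mul_prod hgc
  have hG : Integrable fun ω : ℝ ↦ ((rexp (-(π * ω ^ 2 / t)) : ℝ) : ℂ) := by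
    refine ((integrable_exp_neg_mul_sq (b := π / t) (by positivity)).congr
      (.of_forall fun ω ↦ congrArg rexp ?_)).ofReal
    ring
  have hint : Integrable (Function.uncurry fun (p : ℝ × ℝ) (ω : ℝ) ↦
      Complex.exp (((-2 * π * ω * (p.1 - p.2) : ℝ) : ℂ) * Complex.I) *
      ((f p.1 * (starRingEnd ℂ) (g p.2)) * ((rexp (-(π * ω ^ 2 / t)) : ℝ) : ℂ)))
      (volume.prod volume) := by
    refine (hfg.mul_prod hG).bdd_mul (c := 1) (by fun_prop) (.of_forall fun q ↦ ?_)
    rw [Complex.norm_exp_ofReal_mul_I]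
  have hswap := integral_integral_swap hint
  calc _ = ∫ p : ℝ × ℝ, ((t ^ (-(1 / 2) : ℝ) : ℝ) : ℂ) * ∫ ω : ℝ,
        Complex.exp (((-2 * π * ω * (p.1 - p.2) : ℝ) : ℂ) * Complex.I) *
        ((f p.1 * (starRingEnd ℂ) (g p.2)) * ((rexp (-(π * ω ^ 2 / t)) : ℝ) : ℂ)) := by
        refine integral_congr_ae (.of_forall fun p ↦ ?_)
        simp only
        rw [exp_neg_pi_mul_sq_mul_eq_integral ht, mul_left_comm, ← integral_const_mul]
        congr 2
        ext ω
        ring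
    _ = _ := by
        rw [integral_const_mul, hswap]
        congr 2
        ext ω
        rw [fourier_real_eq_integral_exp_smul, fourier_real_eq_integral_exp_smul, ← integral_conj,
          ← integral_prod_mul, ← integral_mul_const]
        congr 1
        ext p
        simp only [smul_eq_mul, map_mul, ← Complex.exp_conj, Complex.conj_ofReal, Complex.conj_I]
        rw [show (((-2 * π * ω * (p.1 - p.2) : ℝ) : ℂ) * Complex.I) =
          ((-2 * π * p.1 * ω : ℝ) : ℂ) * Complex.I + ((-2 * π * p.2 * ω : ℝ) : ℂ) * -Complex.I by
            push_cast; ring, Complex.exp_add]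
        ring

theorem integral_rpow_mul_exp_neg_pi_sq_mul {a u : ℝ} (ha : 0 < a) (hu : u ≠ 0) :
    ∫ t in Set.Ioi (0 : ℝ), t ^ (a - 1) * rexp (-(π * u ^ 2 * t)) =
      π ^ (-a) * Real.Gamma a * |u| ^ (-(2 * a)) := by
  have hu2 : 0 < u ^ 2 := by positivity
  rw [Real.integral_rpow_mul_exp_neg_mul_Ioi ha (by positivity), one_div,
    Real.inv_rpow (by positivity), ← Real.rpow_neg (by positivity),
    Real.mul_rpow pi_pos.le hu2.le, ← sq_abs, ← Real.rpow_natCast |u| 2,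
    ← Real.rpow_mul (abs_nonneg u)]
  push_cast
  rw [mul_neg]
  ring

theorem integral_rpow_mul_exp_neg_pi_sq_div {a u : ℝ} (ha : 0 < a) (hu : u ≠ 0) :
    ∫ t in Set.Ioi (0 : ℝ), t ^ (-a - 1) * rexp (-(π * u ^ 2 / t)) =
      π ^ (-a) * Real.Gamma a * |u| ^ (-(2 * a)) := by
  rw [← integral_rpow_mul_exp_neg_pi_sq_mul ha hu,
    ← integral_comp_rpow_Ioi (fun t ↦ t ^ (a - 1) * rexp (-(π * u ^ 2 * t)))
      (show (-1 : ℝ) ≠ 0 by norm_num)]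
  refine setIntegral_congr_fun measurableSet_Ioi fun t ht ↦ ?_
  have ht : 0 < t := ht
  simp only [smul_eq_mul, abs_neg, abs_one, one_mul]
  rw [← Real.rpow_mul ht.le, ← mul_assoc, ← Real.rpow_add ht, Real.rpow_neg_one, div_eq_mul_inv]
  ring_nf

/-- Parseval-type identity for the Riesz kernel `|x−y|^{−α}`: for Schwartz functions `f, g`,
`∫∫ f(x) conj(g(y)) |x−y|^{−α} dy dx
  = (π^{α−1/2} Γ((1−α)/2) / Γ(α/2)) ∫ f̃(ω) conj(g̃(ω)) |ω|^{α−1} dω`. -/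
theorem riesz_kernel_parseval_identity
    (α : ℝ) (hα : α ∈ Set.Ioo (0 : ℝ) 1) (f g : SchwartzMap ℝ ℂ) :
    (∫ x : ℝ, ∫ y : ℝ, f x * (starRingEnd ℂ) (g y) * ((|x - y| ^ (-α) : ℝ) : ℂ)) =
      ((π ^ (α - 1 / 2) * Real.Gamma ((1 - α) / 2) / Real.Gamma (α / 2) : ℝ) : ℂ) *
        ∫ ω : ℝ, 𝓕 (f : ℝ → ℂ) ω * (starRingEnd ℂ) (𝓕 (g : ℝ → ℂ) ω) *
          ((|ω| ^ (α - 1) : ℝ) : ℂ) := by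
  obtain ⟨h0, h1⟩ := hα
  have hconj {φ : ℝ → ℂ} (hφ : Integrable φ) : Integrable fun y ↦ (starRingEnd ℂ) (φ y) :=
    (Complex.conjLIE.integrable_comp_iff (φ := φ)).2 hφ
  have hfg : Integrable (fun p : ℝ × ℝ ↦
      f p.1 * (starRingEnd ℂ) (g p.2) * ((|p.1 - p.2| ^ (-α) : ℝ) : ℂ)) :=
    integrable_prod_mul_abs_sub_rpow (g := fun y ↦ (starRingEnd ℂ) (g y)) f.integrable
      (f.norm_le_seminorm ℝ) (hconj g.integrable) (by linarith) (by linarith)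
  have hFG : Integrable (fun ω : ℝ ↦
      𝓕 (f : ℝ → ℂ) ω * (starRingEnd ℂ) (𝓕 (g : ℝ → ℂ) ω)) := by
    rw [← SchwartzMap.fourier_coe, ← SchwartzMap.fourier_coe]
    exact (hconj (𝓕 g).integrable).bdd_mul (𝓕 f).integrable.aestronglyMeasurable
      (.of_forall ((𝓕 f).norm_le_seminorm ℝ))
  have hFGb (ω : ℝ) : ‖𝓕 (f : ℝ → ℂ) ω * (starRingEnd ℂ) (𝓕 (g : ℝ → ℂ) ω)‖ ≤
      SchwartzMap.seminorm ℝ 0 0 (𝓕 f) * SchwartzMap.seminorm ℝ 0 0 (𝓕 g) := by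
    rw [← SchwartzMap.fourier_coe, ← SchwartzMap.fourier_coe, norm_mul, RCLike.norm_conj]
    gcongr
    exacts [(𝓕 f).norm_le_seminorm ℝ ω, (𝓕 g).norm_le_seminorm ℝ ω]
  have hFGK := integrable_mul_abs_rpow hFG hFGb (β := α - 1) (by linarith) (by linarith)
  set A : ℝ := π ^ (-(α / 2)) * Real.Gamma (α / 2) with hA
  set B : ℝ := π ^ (-((1 - α) / 2)) * Real.Gamma ((1 - α) / 2) with hB
  have hΓA : 0 < Real.Gamma (α / 2) := Real.Gamma_pos_of_pos (by linarith)
  have hApos : 0 < A := mul_pos (by positivity) hΓA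
  have hBpos : 0 < B := mul_pos (by positivity) (Real.Gamma_pos_of_pos (by linarith))
  have hne : ∀ᵐ p : ℝ × ℝ, p.1 - p.2 ≠ 0 :=
    (quasiMeasurePreserving_sub_of_right_invariant (volume : Measure ℝ) volume).ae
      (Measure.ae_ne volume 0)
  have time := integral_mul_eq_integral_integral_of_kernel (μ := (volume : Measure (ℝ × ℝ)))
    (ν := volume.restrict (Set.Ioi (0 : ℝ)))
    (F := fun p : ℝ × ℝ ↦ f p.1 * (starRingEnd ℂ) (g p.2))
    (φ := fun p t ↦ t ^ (α / 2 - 1) * rexp (-(π * (p.1 - p.2) ^ 2 * t)))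
    (K := fun p ↦ A * |p.1 - p.2| ^ (-α))
    (f.integrable.mul_prod (hconj g.integrable)).aestronglyMeasurable (by fun_prop)
    (fun p ↦ ae_restrict_of_forall_mem measurableSet_Ioi fun t (ht : 0 < t) ↦ by positivity)
    (by
      filter_upwards [hne] with p hp
      rw [integral_rpow_mul_exp_neg_pi_sq_mul (by linarith) hp, mul_div_cancel₀ α two_ne_zero])
    (by
      filter_upwards [hne] with p hp
      positivity)
    ((hfg.const_mul (A : ℂ)).congr (.of_forall fun p ↦ by push_cast; ring))
  have spectral := integral_mul_eq_integral_integral_of_kernel (μ := (volume : Measure ℝ))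
    (ν := volume.restrict (Set.Ioi (0 : ℝ)))
    (F := fun ω ↦ 𝓕 (f : ℝ → ℂ) ω * (starRingEnd ℂ) (𝓕 (g : ℝ → ℂ) ω))
    (φ := fun ω t ↦ t ^ (-((1 - α) / 2) - 1) * rexp (-(π * ω ^ 2 / t)))
    (K := fun ω ↦ B * |ω| ^ (α - 1))
    hFG.aestronglyMeasurable (by fun_prop)
    (fun p ↦ ae_restrict_of_forall_mem measurableSet_Ioi fun t (ht : 0 < t) ↦ by positivity)
    (by
      filter_upwards [Measure.ae_ne volume 0] with ω hω
      rw [integral_rpow_mul_exp_neg_pi_sq_div (by linarith) hω, mul_div_cancel₀ _ two_ne_zero,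
        neg_sub])
    (by
      filter_upwards [Measure.ae_ne volume 0] with ω hω
      positivity)
    ((hFGK.const_mul (B : ℂ)).congr (.of_forall fun p ↦ by push_cast; ring))
  have hinner : ∀ t ∈ Set.Ioi (0 : ℝ),
      (∫ p : ℝ × ℝ, f p.1 * (starRingEnd ℂ) (g p.2) *
        ((t ^ (α / 2 - 1) * rexp (-(π * (p.1 - p.2) ^ 2 * t)) : ℝ) : ℂ)) =
      ∫ ω : ℝ, 𝓕 (f : ℝ → ℂ) ω * (starRingEnd ℂ) (𝓕 (g : ℝ → ℂ) ω) *
        ((t ^ (-((1 - α) / 2) - 1) * rexp (-(π * ω ^ 2 / t)) : ℝ) : ℂ) := by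
    intro t (ht : 0 < t)
    have hexp : t ^ (-((1 - α) / 2) - 1) = t ^ (α / 2 - 1) * t ^ (-(1 / 2) : ℝ) := by
      rw [← Real.rpow_add ht]
      ring_nf
    rw [integral_mul_ofReal_const_mul, integral_mul_ofReal_const_mul,
      integral_prod_mul_exp_neg_pi_sq_sub f.integrable g.integrable ht, hexp, Complex.ofReal_mul,
      mul_assoc]
  rw [setIntegral_congr_fun measurableSet_Ioi hinner, ← spectral] at time
  rw [integral_mul_ofReal_const_mul, integral_mul_ofReal_const_mul,
    Measure.volume_eq_prod, integral_prod _ hfg] at time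
  have hconst : π ^ (α - 1 / 2) * Real.Gamma ((1 - α) / 2) / Real.Gamma (α / 2) = B / A := by
    have hpi : π ^ (-((1 - α) / 2)) = π ^ (α - 1 / 2) * π ^ (-(α / 2)) := by
      rw [← Real.rpow_add pi_pos]
      ring_nf
    rw [hA, hB, hpi]
    field_simp
  rw [hconst, Complex.ofReal_div, div_mul_eq_mul_div, ← time, mul_div_cancel_left₀]
  exact_mod_cast hApos.ne'
end

section
/- For every H ∈ (0, 1) and every t ∈ ℝ, ∫_ℝ 2(1 − cos(st)) / |s|^{2H+1} ds = (π / (H sin(πH) Γ(2H))) |t|^{2H}. -/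
open MeasureTheory Real

/-- Tonelli's theorem for the Bochner integral on the positive quadrant: the two iterated integrals
of a nonnegative measurable function agree as soon as its sections are integrable. -/
theorem setIntegral_Ioi_swap_of_nonneg {f : ℝ → ℝ → ℝ} (hf : Measurable (Function.uncurry f))
    (h0 : ∀ x > 0, ∀ y > 0, 0 ≤ f x y)
    (hx : ∀ x > 0, IntegrableOn (fun y => f x y) (Set.Ioi 0))
    (hy : ∀ y > 0, IntegrableOn (fun x => f x y) (Set.Ioi 0)) :
    ∫ x in Set.Ioi (0 : ℝ), ∫ y in Set.Ioi (0 : ℝ), f x y =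
      ∫ y in Set.Ioi (0 : ℝ), ∫ x in Set.Ioi (0 : ℝ), f x y := by
  have hf' : Measurable (Function.uncurry fun y x => f x y) := hf.comp measurable_swap
  rw [integral_eq_lintegral_of_nonneg_ae, integral_eq_lintegral_of_nonneg_ae]
  · congr 1
    have e1 : ∫⁻ x in Set.Ioi (0 : ℝ), ENNReal.ofReal (∫ y in Set.Ioi (0 : ℝ), f x y) =
        ∫⁻ x in Set.Ioi (0 : ℝ), ∫⁻ y in Set.Ioi (0 : ℝ), ENNReal.ofReal (f x y) :=
      setLIntegral_congr_fun measurableSet_Ioi fun x hx0 =>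
        ofReal_integral_eq_lintegral_ofReal (hx x hx0)
          ((ae_restrict_iff' measurableSet_Ioi).2 (ae_of_all _ fun y hy0 => h0 x hx0 y hy0))
    have e2 : ∫⁻ y in Set.Ioi (0 : ℝ), ENNReal.ofReal (∫ x in Set.Ioi (0 : ℝ), f x y) =
        ∫⁻ y in Set.Ioi (0 : ℝ), ∫⁻ x in Set.Ioi (0 : ℝ), ENNReal.ofReal (f x y) :=
      setLIntegral_congr_fun measurableSet_Ioi fun y hy0 =>
        ofReal_integral_eq_lintegral_ofReal (hy y hy0)
          ((ae_restrict_iff' measurableSet_Ioi).2 (ae_of_all _ fun x hx0 => h0 x hx0 y hy0))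
    rw [e1, e2]
    exact lintegral_lintegral_swap hf.ennreal_ofReal.aemeasurable
  · exact (ae_restrict_iff' measurableSet_Ioi).2 (ae_of_all _ fun y hy0 =>
      setIntegral_nonneg measurableSet_Ioi fun x hx0 => h0 x hx0 y hy0)
  · exact hf'.stronglyMeasurable.integral_prod_right.aestronglyMeasurable
  · exact (ae_restrict_iff' measurableSet_Ioi).2 (ae_of_all _ fun x hx0 =>
      setIntegral_nonneg measurableSet_Ioi fun y hy0 => h0 x hx0 y hy0)
  · exact hf.stronglyMeasurable.integral_prod_right.aestronglyMeasurable

theorem integral_exp_neg_mul_Ioi_zero {b : ℝ} (hb : 0 < b) :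
    ∫ x in Set.Ioi (0 : ℝ), exp (-b * x) = 1 / b := by
  rw [integral_exp_mul_Ioi (neg_lt_zero.2 hb)]
  simp

theorem integral_rpow_div_one_add_sq {a : ℝ} (ha : 0 < a) (ha1 : a < 1) :
    ∫ u in Set.Ioi (0 : ℝ), u ^ (2 * a - 1) / (1 + u ^ 2) = π / (2 * sin (π * a)) := by
  have hsplit : ∀ u w : ℝ, u ^ (2 * a - 1) * exp (-(1 + u ^ 2) * w) =
      exp (-w) * (u ^ (2 * a - 1) * exp (-w * u ^ (2 : ℝ))) := fun u w => by
    rw [rpow_two, mul_left_comm, ← exp_add]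
    ring_nf
  have key := setIntegral_Ioi_swap_of_nonneg
    (f := fun u w => u ^ (2 * a - 1) * exp (-(1 + u ^ 2) * w))
    (by unfold Function.uncurry; fun_prop)
    (fun x hx y hy => by positivity)
    (fun x hx => (integrableOn_exp_mul_Ioi (by nlinarith [sq_nonneg x]) 0).const_mul _)
    (fun y hy => by
      simp_rw [hsplit]
      exact (integrableOn_rpow_mul_exp_neg_mul_rpow (by linarith) two_pos hy).const_mul _)
  have hl : ∀ u : ℝ, ∫ w in Set.Ioi (0 : ℝ), u ^ (2 * a - 1) * exp (-(1 + u ^ 2) * w) =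
      u ^ (2 * a - 1) / (1 + u ^ 2) := fun u => by
    rw [integral_const_mul, integral_exp_neg_mul_Ioi_zero (by positivity), mul_one_div]
  have hr : ∀ w ∈ Set.Ioi (0 : ℝ),
      ∫ u in Set.Ioi (0 : ℝ), u ^ (2 * a - 1) * exp (-(1 + u ^ 2) * w) =
        Gamma a / 2 * (exp (-w) * w ^ (1 - a - 1)) := fun w hw => by
    simp_rw [hsplit]
    rw [integral_const_mul, integral_rpow_mul_exp_neg_mul_rpow two_pos (by linarith) hw,
      show -(2 * a - 1 + 1) / 2 = 1 - a - 1 by ring, show (2 * a - 1 + 1) / 2 = a by ring]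
    ring
  simp_rw [hl] at key
  rw [key, setIntegral_congr_fun measurableSet_Ioi hr, integral_const_mul,
    ← Gamma_eq_integral (by linarith), div_mul_eq_mul_div, Gamma_mul_Gamma_one_sub]
  rw [div_div, mul_comm (sin _)]

theorem integrableOn_cos_mul_exp_neg_mul_Ioi {b : ℝ} (hb : 0 < b) :
    IntegrableOn (fun x => cos x * exp (-b * x)) (Set.Ioi 0) := by
  refine Integrable.bdd_mul (c := 1) (integrableOn_exp_mul_Ioi (neg_lt_zero.2 hb) 0)
    continuous_cos.aestronglyMeasurable (ae_of_all _ fun x => ?_)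
  exact abs_cos_le_one x

theorem integral_cos_mul_exp_neg_mul_Ioi {b : ℝ} (hb : 0 < b) :
    ∫ x in Set.Ioi (0 : ℝ), cos x * exp (-b * x) = b / (1 + b ^ 2) := by
  have ha : (-(b : ℂ) + Complex.I).re < 0 := by simpa using hb
  have h := congrArg Complex.re (integral_exp_mul_complex_Ioi ha 0)
  have hre := integral_re (integrableOn_exp_mul_complex_Ioi ha 0)
  simp only [RCLike.re_to_complex] at hre
  rw [← hre] at h
  have hcongr : ∀ x : ℝ, (Complex.exp ((-(b : ℂ) + Complex.I) * x)).re = cos x * exp (-b * x) := by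
    intro x
    simp [Complex.exp_re, mul_comm]
  simp_rw [hcongr] at h
  rw [h]
  simp [Complex.div_re, Complex.normSq_apply]
  ring

theorem integral_one_sub_cos_mul_exp_neg_mul_Ioi {b : ℝ} (hb : 0 < b) :
    ∫ x in Set.Ioi (0 : ℝ), (1 - cos x) * exp (-b * x) = 1 / (b * (1 + b ^ 2)) := by
  simp_rw [sub_mul, one_mul]
  rw [integral_sub (integrableOn_exp_mul_Ioi (neg_lt_zero.2 hb) 0)
    (integrableOn_cos_mul_exp_neg_mul_Ioi hb), integral_exp_neg_mul_Ioi_zero hb,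
    integral_cos_mul_exp_neg_mul_Ioi hb]
  field_simp
  ring

theorem integral_one_sub_cos_div_rpow_Ioi {a : ℝ} (ha : 0 < a) (ha1 : a < 1) :
    ∫ s in Set.Ioi (0 : ℝ), (1 - cos s) / s ^ (2 * a + 1) =
      π / (2 * sin (π * a) * Gamma (2 * a + 1)) := by
  have hG : 0 < Gamma (2 * a + 1) := Gamma_pos_of_pos (by linarith)
  have hcos : ∀ x : ℝ, 0 ≤ 1 - cos x := fun x => sub_nonneg.2 (cos_le_one x)
  have hs1 : ∀ s u : ℝ, u ^ (2 * a) * ((1 - cos s) * exp (-u * s)) =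
      (1 - cos s) * (u ^ (2 * a + 1 - 1) * exp (-(s * u))) := fun s u => by
    rw [add_sub_cancel_right, mul_left_comm]
    ring_nf
  have key := setIntegral_Ioi_swap_of_nonneg
    (f := fun s u => u ^ (2 * a) * ((1 - cos s) * exp (-u * s)))
    (by unfold Function.uncurry; fun_prop)
    (fun x hx y hy => mul_nonneg (by positivity) (mul_nonneg (hcos x) (by positivity)))
    (fun s hs => by
      simp_rw [hs1]
      have := integrableOn_rpow_mul_exp_neg_mul_rpow (s := 2 * a + 1 - 1) (by linarith)
        one_pos hs
      simp_rw [rpow_one, neg_mul] at this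
      exact this.const_mul _)
    (fun u hu => by
      refine Integrable.const_mul ?_ _
      simp_rw [sub_mul, one_mul]
      exact (integrableOn_exp_mul_Ioi (neg_lt_zero.2 hu) 0).sub
        (integrableOn_cos_mul_exp_neg_mul_Ioi hu))
  have hl : ∀ s ∈ Set.Ioi (0 : ℝ),
      ∫ u in Set.Ioi (0 : ℝ), u ^ (2 * a) * ((1 - cos s) * exp (-u * s)) =
        Gamma (2 * a + 1) * ((1 - cos s) / s ^ (2 * a + 1)) := fun s hs => by
    simp_rw [hs1]
    rw [integral_const_mul, integral_rpow_mul_exp_neg_mul_Ioi (by linarith) hs,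
      div_rpow zero_le_one (le_of_lt hs), one_rpow]
    ring
  have hr : ∀ u ∈ Set.Ioi (0 : ℝ),
      ∫ s in Set.Ioi (0 : ℝ), u ^ (2 * a) * ((1 - cos s) * exp (-u * s)) =
        u ^ (2 * a - 1) / (1 + u ^ 2) := fun u hu => by
    have hu : 0 < u := hu
    rw [integral_const_mul, integral_one_sub_cos_mul_exp_neg_mul_Ioi hu, rpow_sub_one hu.ne']
    field_simp
  rw [setIntegral_congr_fun measurableSet_Ioi hl, setIntegral_congr_fun measurableSet_Ioi hr,
    integral_const_mul, integral_rpow_div_one_add_sq ha ha1] at key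
  rw [← div_div, ← key, mul_div_cancel_left₀ _ hG.ne']



/-- Spectral variance identity for fractional Brownian motion: for `H ∈ (0,1)` and `t ∈ ℝ`,
`∫_ℝ 2(1 − cos(st)) / |s|^{2H+1} ds = (π / (H sin(πH) Γ(2H))) |t|^{2H}`. -/
theorem fBm_spectral_variance_integral
    (H : ℝ) (hH : H ∈ Set.Ioo (0 : ℝ) 1) (t : ℝ) :
    (∫ s : ℝ, 2 * (1 - Real.cos (s * t)) / |s| ^ (2 * H + 1)) =
      π / (H * Real.sin (π * H) * Real.Gamma (2 * H)) * |t| ^ (2 * H) := by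
  obtain ⟨h0, h1⟩ := hH
  rcases eq_or_ne t 0 with rfl | ht
  · simp [zero_rpow (by linarith : 2 * H ≠ 0)]
  have htp : 0 < |t| := abs_pos.2 ht
  have hunit : ∫ s : ℝ, 2 * (1 - cos s) / |s| ^ (2 * H + 1) =
      π / (H * sin (π * H) * Gamma (2 * H)) := by
    have habs := integral_comp_abs (f := fun s => 2 * ((1 - cos s) / s ^ (2 * H + 1)))
    simp only [cos_abs, ← mul_div_assoc] at habs
    rw [habs]
    simp only [mul_div_assoc]
    rw [integral_const_mul, integral_one_sub_cos_div_rpow_Ioi h0 h1,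
      Gamma_add_one (by linarith)]
    have hs : sin (π * H) ≠ 0 :=
      (sin_pos_of_pos_of_lt_pi (by positivity) (by nlinarith [pi_pos])).ne'
    have hG : Gamma (2 * H) ≠ 0 := (Gamma_pos_of_pos (by linarith)).ne'
    field_simp
  have hscale : ∀ s : ℝ, 2 * (1 - cos (s * t)) / |s| ^ (2 * H + 1) =
      |t| ^ (2 * H + 1) * (2 * (1 - cos (s * t)) / |s * t| ^ (2 * H + 1)) := fun s => by
    rw [abs_mul, mul_rpow (abs_nonneg _) (abs_nonneg _), mul_comm (|s| ^ _), ← div_div,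
      div_right_comm _ (|t| ^ _), mul_div_cancel₀]
    positivity
  simp_rw [hscale]
  rw [integral_const_mul,
    Measure.integral_comp_mul_right (fun s => 2 * (1 - cos s) / |s| ^ (2 * H + 1)), hunit,
    rpow_add_one htp.ne', abs_inv, smul_eq_mul]
  field_simp
end

section
/- For every H ∈ (1/2, 1) and every t ∈ ℝ, ∫_ℝ ((t−s)_+^{H−1/2} − (−s)_+^{H−1/2})² ds = (Γ(H+1/2)² / (2H sin(πH) Γ(2H))) |t|^{2H}, where x_+ = x 𝟙_{x>0}. -/
open MeasureTheory Real

theorem lintegral_rpow_mul_exp_neg_mul_Ioi {p c : ℝ} (hp : 0 < p) (hc : 0 < c) :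
    ∫⁻ r in Set.Ioi (0 : ℝ), ENNReal.ofReal (r ^ (p - 1) * exp (-(c * r))) =
      ENNReal.ofReal (Real.Gamma p * c ^ (-p)) := by
  have h := integral_rpow_mul_exp_neg_mul_Ioi hp hc
  have hpos : 0 < (1 / c) ^ p * Real.Gamma p := by
    have := Real.Gamma_pos_of_pos hp
    positivity
  have hint : IntegrableOn (fun r : ℝ => r ^ (p - 1) * exp (-(c * r))) (Set.Ioi 0) :=
    not_imp_comm.1 integral_undef (by rw [h]; exact hpos.ne')
  rw [← ofReal_integral_eq_lintegral_ofReal hint, h, one_div, inv_rpow hc.le, rpow_neg hc.le,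
    mul_comm]
  filter_upwards [ae_restrict_mem measurableSet_Ioi] with r hr
  have : (0 : ℝ) < r := hr
  simp only [Pi.zero_apply]
  positivity

theorem lintegral_rpow_mul_add_rpow_Ioi {a d : ℝ} (ha : 0 < a) (ha' : a < 1 / 2) (hd : 0 < d) :
    ∫⁻ v in Set.Ioi (0 : ℝ), ENNReal.ofReal (v ^ (a - 1) * (v + d) ^ (a - 1)) =
      ENNReal.ofReal (Real.Gamma a * Real.Gamma (1 - 2 * a) / Real.Gamma (1 - a) *
        d ^ (2 * a - 1)) := by
  have hG : 0 < Real.Gamma (1 - a) := Real.Gamma_pos_of_pos (by linarith)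
  have hGa : 0 < Real.Gamma a := Real.Gamma_pos_of_pos ha
  have key : ENNReal.ofReal (Real.Gamma (1 - a)) *
      ∫⁻ v in Set.Ioi (0 : ℝ), ENNReal.ofReal (v ^ (a - 1) * (v + d) ^ (a - 1)) =
      ENNReal.ofReal (Real.Gamma a * (Real.Gamma (1 - 2 * a) * d ^ (2 * a - 1))) := by
    calc
      _ = ∫⁻ v in Set.Ioi (0 : ℝ), ∫⁻ r in Set.Ioi (0 : ℝ),
            ENNReal.ofReal (v ^ (a - 1) * (r ^ (-a) * exp (-((v + d) * r)))) := by
        rw [← lintegral_const_mul' _ _ ENNReal.ofReal_ne_top]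
        refine setLIntegral_congr_fun measurableSet_Ioi fun v hv => ?_
        have hv : (0 : ℝ) < v := hv
        have h := lintegral_rpow_mul_exp_neg_mul_Ioi (p := 1 - a) (c := v + d)
          (by linarith) (by linarith)
        simp only [ENNReal.ofReal_mul (rpow_nonneg hv.le (a - 1))]
        rw [lintegral_const_mul' _ _ ENNReal.ofReal_ne_top]
        rw [show (1 : ℝ) - a - 1 = -a by ring, show -(1 - a) = a - 1 by ring] at h
        rw [h, ENNReal.ofReal_mul hG.le]
        ring
      _ = ∫⁻ r in Set.Ioi (0 : ℝ), ∫⁻ v in Set.Ioi (0 : ℝ),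
            ENNReal.ofReal (v ^ (a - 1) * (r ^ (-a) * exp (-((v + d) * r)))) :=
        lintegral_lintegral_swap (by fun_prop)
      _ = ∫⁻ r in Set.Ioi (0 : ℝ), ENNReal.ofReal (Real.Gamma a) *
            ENNReal.ofReal (r ^ (1 - 2 * a - 1) * exp (-(d * r))) := by
        refine setLIntegral_congr_fun measurableSet_Ioi fun r hr => ?_
        have hr : (0 : ℝ) < r := hr
        have h := lintegral_rpow_mul_exp_neg_mul_Ioi ha hr
        have e : ∀ v : ℝ, v ^ (a - 1) * (r ^ (-a) * exp (-((v + d) * r))) =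
            (r ^ (-a) * exp (-(d * r))) * (v ^ (a - 1) * exp (-(r * v))) := fun v => by
          rw [show -((v + d) * r) = -(d * r) + -(r * v) by ring, exp_add]
          ring
        have hn : 0 ≤ r ^ (-a) * exp (-(d * r)) := by positivity
        simp only [e, ENNReal.ofReal_mul hn]
        rw [lintegral_const_mul' _ _ ENNReal.ofReal_ne_top, h, ← ENNReal.ofReal_mul hn,
          ← ENNReal.ofReal_mul hGa.le, show 1 - 2 * a - 1 = -a + -a by ring, rpow_add hr]
        congr 1
        ring
      _ = _ := by
        rw [lintegral_const_mul' _ _ ENNReal.ofReal_ne_top,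
          lintegral_rpow_mul_exp_neg_mul_Ioi (by linarith) hd, ← ENNReal.ofReal_mul hGa.le,
          show -(1 - 2 * a) = 2 * a - 1 by ring]
  rw [(ENNReal.eq_div_iff (by simpa using hG) ENNReal.ofReal_ne_top).2 key,
    ← ENNReal.ofReal_div_of_pos hG]
  congr 1
  ring

theorem ofReal_max_rpow_sub_max_rpow {a : ℝ} (ha : 0 < a) (ha' : a < 1) {u v : ℝ} (huv : u ≤ v) :
    ENNReal.ofReal (max v 0 ^ a - max u 0 ^ a) =
      ∫⁻ z in Set.Ioc u v, ENNReal.ofReal (a * max z 0 ^ (a - 1)) := by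
  have hn : ∀ z : ℝ, 0 ≤ a * max z 0 ^ (a - 1) := fun z => by positivity
  have hcont : Continuous fun z : ℝ => max z 0 ^ a :=
    (continuous_id.max continuous_const).rpow_const fun _ => Or.inr ha.le
  have hderiv : ∀ z : ℝ, z ≠ 0 →
      HasDerivAt (fun z : ℝ => max z 0 ^ a) (a * max z 0 ^ (a - 1)) z := fun z hz => by
    rcases hz.lt_or_gt with hz | hz
    · rw [max_eq_right hz.le, zero_rpow (by linarith), mul_zero]
      refine (hasDerivAt_const z (0 : ℝ)).congr_of_eventuallyEq ?_
      filter_upwards [eventually_lt_nhds hz] with w hw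
      rw [max_eq_right hw.le, zero_rpow ha.ne']
    · rw [max_eq_left hz.le]
      refine (hasDerivAt_rpow_const (Or.inl hz.ne')).congr_of_eventuallyEq ?_
      filter_upwards [eventually_gt_nhds hz] with w hw
      rw [max_eq_left hw.le]
  have hint : IntervalIntegrable (fun z : ℝ => a * max z 0 ^ (a - 1)) volume u v := by
    have h := (intervalIntegral.intervalIntegrable_rpow' (a := u) (b := v) (r := a - 1)
      (by linarith)).const_mul a
    rw [intervalIntegrable_iff] at h ⊢
    refine (h.integrable.indicator (measurableSet_Ioi (a := (0 : ℝ)))).congr (.of_forall fun z => ?_)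
    by_cases hz : 0 < z
    · simp [hz, max_eq_left hz.le]
    · simp [hz, max_eq_right (not_lt.1 hz), zero_rpow (show a - 1 ≠ 0 by linarith)]
  have h := integral_eq_of_hasDerivAt_off_countable_of_le _ _ huv
    (Set.countable_singleton (0 : ℝ)) hcont.continuousOn (fun z hz => hderiv z hz.2) hint
  rw [← h, intervalIntegral.integral_of_le huv, ofReal_integral_eq_lintegral_ofReal
    ((intervalIntegrable_iff_integrableOn_Ioc_of_le huv).1 hint) (.of_forall hn)]

theorem setLIntegral_max_sub_rpow {a : ℝ} (ha : 0 < a) (ha' : a < 1) {u v : ℝ} (huv : u ≤ v)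
    (x : ℝ) :
    ∫⁻ y in Set.Ioc u v, ENNReal.ofReal (a * max (y - x) 0 ^ (a - 1)) =
      ENNReal.ofReal (max (v - x) 0 ^ a - max (u - x) 0 ^ a) := by
  have h := (measurePreserving_sub_right volume x).setLIntegral_comp_preimage
    (f := fun z => ENNReal.ofReal (a * max z 0 ^ (a - 1)))
    (measurableSet_Ioc (a := u - x) (b := v - x)) (by fun_prop)
  rw [Set.preimage_sub_const_Ioc, sub_add_cancel, sub_add_cancel] at h
  rw [h, ofReal_max_rpow_sub_max_rpow ha ha' (sub_le_sub_right huv x)]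

theorem setLIntegral_max_const_sub_rpow {a : ℝ} (ha : 0 < a) (ha' : a < 1) {u v : ℝ}
    (huv : u ≤ v) (x : ℝ) :
    ∫⁻ y in Set.Ioc u v, ENNReal.ofReal (a * max (x - y) 0 ^ (a - 1)) =
      ENNReal.ofReal (max (x - u) 0 ^ a - max (x - v) 0 ^ a) := by
  have h := (Measure.measurePreserving_sub_left volume x).setLIntegral_comp_preimage
    (f := fun z => ENNReal.ofReal (a * max z 0 ^ (a - 1)))
    (measurableSet_Ioc (a := x - v) (b := x - u)) (by fun_prop)
  rw [Set.preimage_const_sub_Ioc, sub_sub_cancel, sub_sub_cancel,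
    Measure.restrict_congr_set Ico_ae_eq_Ioc] at h
  rw [h, ofReal_max_rpow_sub_max_rpow ha ha' (sub_le_sub_left huv x)]

theorem lintegral_abs_sub_rpow {b t x : ℝ} (hb : 0 < b) (hb' : b < 1) (hx : x ∈ Set.Ioc 0 t) :
    ∫⁻ y in Set.Ioc 0 t, ENNReal.ofReal (b * |x - y| ^ (b - 1)) =
      ENNReal.ofReal (x ^ b + (t - x) ^ b) := by
  have ht : 0 ≤ t := hx.1.le.trans hx.2
  have e : ∀ y : ℝ, ENNReal.ofReal (b * |x - y| ^ (b - 1)) =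
      ENNReal.ofReal (b * max (x - y) 0 ^ (b - 1)) +
        ENNReal.ofReal (b * max (y - x) 0 ^ (b - 1)) := fun y => by
    have hb1 : b - 1 ≠ 0 := by linarith
    rcases le_total x y with h | h
    · rw [abs_of_nonpos (by linarith), max_eq_right (by linarith), max_eq_left (by linarith),
        zero_rpow hb1, neg_sub]
      simp
    · rw [abs_of_nonneg (by linarith), max_eq_left (by linarith), max_eq_right (by linarith),
        zero_rpow hb1]
      simp
  simp only [e]
  rw [lintegral_add_left (by fun_prop), setLIntegral_max_const_sub_rpow hb hb' ht,
    setLIntegral_max_sub_rpow hb hb' ht, max_eq_right (by linarith [hx.2] : x - t ≤ 0),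
    max_eq_right (by linarith [hx.1] : 0 - x ≤ 0), zero_rpow hb.ne', sub_zero, sub_zero, sub_zero,
    max_eq_left hx.1.le, max_eq_left (sub_nonneg.2 hx.2), ENNReal.ofReal_add]
  · exact rpow_nonneg hx.1.le _
  · exact rpow_nonneg (sub_nonneg.2 hx.2) _

theorem lintegral_lintegral_abs_sub_rpow {b t : ℝ} (hb : 0 < b) (hb' : b < 1) (ht : 0 ≤ t) :
    ∫⁻ x in Set.Ioc 0 t, ∫⁻ y in Set.Ioc 0 t, ENNReal.ofReal (b * |x - y| ^ (b - 1)) =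
      ENNReal.ofReal (2 * t ^ (b + 1) / (b + 1)) := by
  rw [setLIntegral_congr_fun measurableSet_Ioc fun x hx => lintegral_abs_sub_rpow hb hb' hx]
  have h1 : Continuous fun x : ℝ => x ^ b := continuous_id.rpow_const fun _ => Or.inr hb.le
  have h2 : Continuous fun x : ℝ => (t - x) ^ b := h1.comp (continuous_const.sub continuous_id)
  have h3 := (h1.add h2).integrableOn_Ioc (a := 0) (b := t) (μ := volume)
  simp only [Pi.add_def] at h3
  rw [← ofReal_integral_eq_lintegral_ofReal h3, ← intervalIntegral.integral_of_le ht,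
    intervalIntegral.integral_add (h1.intervalIntegrable _ _) (h2.intervalIntegrable _ _),
    intervalIntegral.integral_comp_sub_left (fun x : ℝ => x ^ b), sub_self, sub_zero,
    integral_rpow (Or.inl (by linarith)), zero_rpow (by linarith)]
  · congr 1
    ring
  · filter_upwards [ae_restrict_mem measurableSet_Ioc] with x hx
    exact add_nonneg (rpow_nonneg hx.1.le _) (rpow_nonneg (sub_nonneg.2 hx.2) _)

theorem lintegral_max_sub_rpow_mul_max_sub_rpow {a x y : ℝ} (ha : 0 < a) (ha' : a < 1 / 2)
    (hxy : x ≠ y) :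
    ∫⁻ s : ℝ, ENNReal.ofReal (a * max (x - s) 0 ^ (a - 1)) *
        ENNReal.ofReal (a * max (y - s) 0 ^ (a - 1)) =
      ENNReal.ofReal (a * Real.Gamma a * Real.Gamma (1 - 2 * a) / (2 * Real.Gamma (1 - a))) *
        ENNReal.ofReal (2 * a * |x - y| ^ (2 * a - 1)) := by
  wlog h : x < y generalizing x y
  · rw [abs_sub_comm, ← this hxy.symm (lt_of_le_of_ne (not_lt.1 h) hxy.symm)]
    simp only [mul_comm]
  have hG : 0 < Real.Gamma (1 - a) := Real.Gamma_pos_of_pos (by linarith)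
  have hG2 : 0 < Real.Gamma (1 - 2 * a) := Real.Gamma_pos_of_pos (by linarith)
  have hGa : 0 < Real.Gamma a := Real.Gamma_pos_of_pos ha
  rw [← lintegral_sub_left_eq_self _ x]
  have e : ∀ v : ℝ, ENNReal.ofReal (a * max (x - (x - v)) 0 ^ (a - 1)) *
      ENNReal.ofReal (a * max (y - (x - v)) 0 ^ (a - 1)) =
      (Set.Ioi (0 : ℝ)).indicator (fun v => ENNReal.ofReal (a ^ 2) *
        ENNReal.ofReal (v ^ (a - 1) * (v + (y - x)) ^ (a - 1))) v := fun v => by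
    by_cases hv : 0 < v
    · rw [Set.indicator_of_mem (Set.mem_Ioi.2 hv), sub_sub_cancel, max_eq_left hv.le,
        max_eq_left (by linarith), ← ENNReal.ofReal_mul (by positivity),
        ← ENNReal.ofReal_mul (by positivity)]
      congr 1
      rw [show y - (x - v) = v + (y - x) by ring]
      ring
    · rw [Set.indicator_of_notMem (by simpa using hv), sub_sub_cancel,
        max_eq_right (not_lt.1 hv), zero_rpow (by linarith)]
      simp
  simp only [e]
  rw [lintegral_indicator measurableSet_Ioi, lintegral_const_mul' _ _ ENNReal.ofReal_ne_top,
    lintegral_rpow_mul_add_rpow_Ioi ha ha' (sub_pos.2 h), abs_sub_comm,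
    abs_of_pos (sub_pos.2 h), ← ENNReal.ofReal_mul (by positivity),
    ← ENNReal.ofReal_mul (by positivity)]
  congr 1
  field_simp

theorem lintegral_sq_max_rpow_sub_max_rpow {a t : ℝ} (ha : 0 < a) (ha' : a < 1 / 2)
    (ht : 0 ≤ t) :
    ∫⁻ s : ℝ, ENNReal.ofReal ((max (t - s) 0 ^ a - max (-s) 0 ^ a) ^ 2) =
      ENNReal.ofReal (a * Real.Gamma a * Real.Gamma (1 - 2 * a) /
        ((2 * a + 1) * Real.Gamma (1 - a)) * t ^ (2 * a + 1)) := by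
  have hG : 0 < Real.Gamma (1 - a) := Real.Gamma_pos_of_pos (by linarith)
  have hG2 : 0 < Real.Gamma (1 - 2 * a) := Real.Gamma_pos_of_pos (by linarith)
  have hGa : 0 < Real.Gamma a := Real.Gamma_pos_of_pos ha
  calc
    _ = ∫⁻ s : ℝ, ∫⁻ x in Set.Ioc 0 t, ∫⁻ y in Set.Ioc 0 t,
          ENNReal.ofReal (a * max (x - s) 0 ^ (a - 1)) *
            ENNReal.ofReal (a * max (y - s) 0 ^ (a - 1)) := by
      refine lintegral_congr fun s => ?_
      have h := setLIntegral_max_sub_rpow ha (by linarith) ht s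
      rw [zero_sub] at h
      have hn : 0 ≤ max (t - s) 0 ^ a - max (-s) 0 ^ a :=
        sub_nonneg.2 (rpow_le_rpow (le_max_right _ _) (max_le_max (by linarith) le_rfl) ha.le)
      simp_rw [lintegral_const_mul' _ _ ENNReal.ofReal_ne_top, h]
      rw [lintegral_mul_const' _ _ ENNReal.ofReal_ne_top, h, ← ENNReal.ofReal_mul hn, sq]
    _ = ∫⁻ x in Set.Ioc 0 t, ∫⁻ y in Set.Ioc 0 t, ∫⁻ s : ℝ,
          ENNReal.ofReal (a * max (x - s) 0 ^ (a - 1)) *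
            ENNReal.ofReal (a * max (y - s) 0 ^ (a - 1)) := by
      rw [lintegral_lintegral_swap]
      · exact lintegral_congr fun x => lintegral_lintegral_swap (by fun_prop)
      · exact (Measurable.lintegral_prod_right' (f := fun p : (ℝ × ℝ) × ℝ =>
          ENNReal.ofReal (a * max (p.1.2 - p.1.1) 0 ^ (a - 1)) *
            ENNReal.ofReal (a * max (p.2 - p.1.1) 0 ^ (a - 1))) (by fun_prop)).aemeasurable
    _ = ∫⁻ x in Set.Ioc 0 t, ∫⁻ y in Set.Ioc 0 t,
          ENNReal.ofReal (a * Real.Gamma a * Real.Gamma (1 - 2 * a) / (2 * Real.Gamma (1 - a))) *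
            ENNReal.ofReal (2 * a * |x - y| ^ (2 * a - 1)) := by
      refine lintegral_congr fun x => lintegral_congr_ae (ae_restrict_of_ae ?_)
      filter_upwards [Measure.ae_ne volume x] with y hy
      exact lintegral_max_sub_rpow_mul_max_sub_rpow ha ha' hy.symm
    _ = _ := by
      simp_rw [lintegral_const_mul' _ _ ENNReal.ofReal_ne_top]
      rw [lintegral_lintegral_abs_sub_rpow (by linarith) (by linarith) ht,
        ← ENNReal.ofReal_mul (by positivity)]
      congr 1
      field_simp

theorem integral_sq_max_rpow_sub_max_rpow {a t : ℝ} (ha : 0 < a) (ha' : a < 1 / 2)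
    (ht : 0 ≤ t) :
    ∫ s : ℝ, (max (t - s) 0 ^ a - max (-s) 0 ^ a) ^ 2 =
      a * Real.Gamma a * Real.Gamma (1 - 2 * a) / ((2 * a + 1) * Real.Gamma (1 - a)) *
        t ^ (2 * a + 1) := by
  have hG : 0 < Real.Gamma (1 - a) := Real.Gamma_pos_of_pos (by linarith)
  have hG2 : 0 < Real.Gamma (1 - 2 * a) := Real.Gamma_pos_of_pos (by linarith)
  have hGa : 0 < Real.Gamma a := Real.Gamma_pos_of_pos ha
  rw [integral_eq_lintegral_of_nonneg_ae (.of_forall fun s => sq_nonneg _)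
    (by fun_prop : Measurable _).aestronglyMeasurable,
    lintegral_sq_max_rpow_sub_max_rpow ha ha' ht, ENNReal.toReal_ofReal (by positivity)]

theorem integral_sq_max_rpow_sub_max_rpow_neg (a t : ℝ) :
    ∫ s : ℝ, (max (-t - s) 0 ^ a - max (-s) 0 ^ a) ^ 2 =
      ∫ s : ℝ, (max (t - s) 0 ^ a - max (-s) 0 ^ a) ^ 2 := by
  rw [← integral_sub_right_eq_self _ t]
  refine integral_congr_ae (.of_forall fun s => ?_)
  simp only [show -t - (s - t) = -s by ring, show -(s - t) = t - s by ring]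
  ring

theorem mul_Gamma_mul_Gamma_div_Gamma_eq {a : ℝ} (ha : 0 < a) (ha' : a < 1 / 2) :
    a * Real.Gamma a * Real.Gamma (1 - 2 * a) / Real.Gamma (1 - a) =
      Real.Gamma (a + 1) ^ 2 / (cos (π * a) * Real.Gamma (2 * a + 1)) := by
  have hG : 0 < Real.Gamma (1 - a) := Real.Gamma_pos_of_pos (by linarith)
  have hG2 : 0 < Real.Gamma (2 * a) := Real.Gamma_pos_of_pos (by linarith)
  have hs : 0 < sin (π * a) := sin_pos_of_pos_of_lt_pi (by positivity) (by nlinarith [pi_pos])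
  have hc : 0 < cos (π * a) :=
    cos_pos_of_mem_Ioo ⟨by nlinarith [pi_pos], by nlinarith [pi_pos]⟩
  have h1 := Real.Gamma_mul_Gamma_one_sub a
  have h2 := Real.Gamma_mul_Gamma_one_sub (2 * a)
  rw [show π * (2 * a) = 2 * (π * a) by ring, sin_two_mul] at h2
  rw [Real.Gamma_add_one ha.ne', Real.Gamma_add_one (by positivity)]
  rw [eq_div_iff (by positivity)] at h1 h2
  rw [div_eq_div_iff hG.ne' (by positivity)]
  apply mul_right_cancel₀ hs.ne'
  linear_combination a ^ 2 * Real.Gamma a * h2 - a ^ 2 * Real.Gamma a * h1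

/-- Moving-average variance identity for fractional Brownian motion: for `H ∈ (1/2,1)` and
`t ∈ ℝ`,
`∫_ℝ ((t−s)₊^{H−1/2} − (−s)₊^{H−1/2})² ds = (Γ(H+1/2)² / (2H sin(πH) Γ(2H))) |t|^{2H}`. -/
theorem fBm_moving_average_variance_integral
    (H : ℝ) (hH : H ∈ Set.Ioo (1 / 2 : ℝ) 1) (t : ℝ) :
    (∫ s : ℝ, (max (t - s) 0 ^ (H - 1 / 2) - max (-s) 0 ^ (H - 1 / 2)) ^ 2) =
      Real.Gamma (H + 1 / 2) ^ 2 / (2 * H * Real.sin (π * H) * Real.Gamma (2 * H)) *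
        |t| ^ (2 * H) := by
  obtain ⟨a, rfl⟩ : ∃ a, H = a + 1 / 2 := ⟨H - 1 / 2, by ring⟩
  have ha : 0 < a := by linarith [hH.1]
  have ha' : a < 1 / 2 := by linarith [hH.2]
  have habs : ∫ s : ℝ, (max (t - s) 0 ^ a - max (-s) 0 ^ a) ^ 2 =
      ∫ s : ℝ, (max (|t| - s) 0 ^ a - max (-s) 0 ^ a) ^ 2 := by
    rcases abs_choice t with h | h
    · rw [h]
    · rw [h, integral_sq_max_rpow_sub_max_rpow_neg]
  rw [add_sub_cancel_right, habs, integral_sq_max_rpow_sub_max_rpow ha ha' (abs_nonneg t),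
    show a + 1 / 2 + 1 / 2 = a + 1 by ring, show 2 * (a + 1 / 2) = 2 * a + 1 by ring,
    show π * (a + 1 / 2) = π * a + π / 2 by ring, sin_add_pi_div_two, mul_comm (2 * a + 1),
    ← div_div, mul_Gamma_mul_Gamma_div_Gamma_eq ha ha', div_div]
  congr 2
  ring
end

section
/- For every H ∈ (1/2, 1) and all t, u ∈ ℝ, ∫_ℝ ((t−s)_+^{H−1/2} − (−s)_+^{H−1/2}) ((u−s)_+^{H−1/2} − (−s)_+^{H−1/2}) ds = (Γ(H+1/2)² / (2H sin(πH) Γ(2H))) · (1/2)(|t|^{2H} + |u|^{2H} − |t−u|^{2H}), where x_+ = x 𝟙_{x>0}. -/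
open MeasureTheory Real

theorem hasDerivAt_max_rpow_div {p x : ℝ} (hp : 0 < p) (hp1 : p ≠ 1) (hx : x ≠ 0) :
    HasDerivAt (fun x : ℝ => max x 0 ^ p / p) (max x 0 ^ (p - 1)) x := by
  rcases lt_or_gt_of_ne hx with h | h
  · rw [max_eq_right h.le, zero_rpow (sub_ne_zero.2 hp1)]
    refine (hasDerivAt_const x (0 : ℝ)).congr_of_eventuallyEq ?_
    filter_upwards [Iio_mem_nhds h] with y hy
    rw [max_eq_right (le_of_lt hy), zero_rpow hp.ne', zero_div]
  · rw [max_eq_left h.le]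
    have := (Real.hasDerivAt_rpow_const (p := p) (Or.inl hx)).div_const p
    rw [mul_div_cancel_left₀ _ hp.ne'] at this
    refine this.congr_of_eventuallyEq ?_
    filter_upwards [Ioi_mem_nhds h] with y hy
    rw [max_eq_left (le_of_lt hy)]

theorem intervalIntegrable_max_rpow {p : ℝ} (hp : 0 < p) (hp1 : p ≠ 1) (a b : ℝ) :
    IntervalIntegrable (fun x : ℝ => max x 0 ^ (p - 1)) volume a b := by
  have h := intervalIntegral.intervalIntegrable_rpow' (a := a) (b := b) (r := p - 1) (by linarith)
  refine h.mono_fun (Measurable.aestronglyMeasurable (by fun_prop))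
    (Filter.Eventually.of_forall fun x => ?_)
  dsimp only
  rcases le_or_gt x 0 with hx | hx
  · rw [max_eq_right hx, zero_rpow (sub_ne_zero.2 hp1), norm_zero]
    exact norm_nonneg _
  · rw [max_eq_left hx.le]

theorem lintegral_Ioc_max_rpow {p : ℝ} (hp : 0 < p) (hp1 : p ≠ 1) {a b : ℝ} (hab : a ≤ b) :
    ∫⁻ x in Set.Ioc a b, ENNReal.ofReal (max x 0 ^ (p - 1)) =
      ENNReal.ofReal ((max b 0 ^ p - max a 0 ^ p) / p) := by
  have hi := intervalIntegrable_max_rpow hp hp1 a b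
  rw [← ofReal_integral_eq_lintegral_ofReal
    ((intervalIntegrable_iff_integrableOn_Ioc_of_le hab).1 hi)
    (Filter.Eventually.of_forall fun x => by positivity),
    ← intervalIntegral.integral_of_le hab, sub_div]
  congr 1
  refine integral_eq_of_hasDerivAt_off_countable_of_le
    (fun x : ℝ => max x 0 ^ p / p) _ hab (Set.countable_singleton 0) ?_
    (fun x hx => hasDerivAt_max_rpow_div hp hp1 hx.2) hi
  exact ((continuous_id.max continuous_const).rpow_const
    fun x => Or.inr hp.le).div_const p |>.continuousOn

theorem lintegral_Ioc_max_sub_rpow {p : ℝ} (hp : 0 < p) (hp1 : p ≠ 1) {a b : ℝ} (hab : a ≤ b)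
    (s : ℝ) :
    ∫⁻ x in Set.Ioc a b, ENNReal.ofReal (max (x - s) 0 ^ (p - 1)) =
      ENNReal.ofReal ((max (b - s) 0 ^ p - max (a - s) 0 ^ p) / p) := by
  have h := (measurePreserving_sub_right volume s).setLIntegral_comp_preimage
    (measurableSet_Ioc (a := a - s) (b := b - s))
    (f := fun x : ℝ => ENNReal.ofReal (max x 0 ^ (p - 1))) (by fun_prop)
  rw [lintegral_Ioc_max_rpow hp hp1 (sub_le_sub_right hab s)] at h
  simpa using h

theorem lintegral_Ioc_max_const_sub_rpow {p : ℝ} (hp : 0 < p) (hp1 : p ≠ 1) {a b : ℝ}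
    (hab : a ≤ b) (s : ℝ) :
    ∫⁻ x in Set.Ioc a b, ENNReal.ofReal (max (s - x) 0 ^ (p - 1)) =
      ENNReal.ofReal ((max (s - a) 0 ^ p - max (s - b) 0 ^ p) / p) := by
  have h := (Measure.measurePreserving_sub_left volume s).setLIntegral_comp_preimage
    (measurableSet_Ioo (a := s - b) (b := s - a))
    (f := fun x : ℝ => ENNReal.ofReal (max x 0 ^ (p - 1))) (by fun_prop)
  rw [setLIntegral_congr Ioo_ae_eq_Ioc, lintegral_Ioc_max_rpow hp hp1 (sub_le_sub_left hab s)] at h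
  rw [← setLIntegral_congr Ioo_ae_eq_Ioc]
  simpa using h

theorem lintegral_rpow_mul_exp_neg_mul {a b : ℝ} (ha : 0 < a) (hb : 0 < b) :
    ∫⁻ y in Set.Ioi (0 : ℝ), ENNReal.ofReal (y ^ (a - 1) * exp (-(b * y))) =
      ENNReal.ofReal ((1 / b) ^ a * Gamma a) := by
  have h := integral_rpow_mul_exp_neg_mul_Ioi ha hb
  have hpos : 0 < (1 / b) ^ a * Gamma a := mul_pos (by positivity) (Gamma_pos_of_pos ha)
  rw [← h, ofReal_integral_eq_lintegral_ofReal]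
  · exact Integrable.of_integral_ne_zero (h ▸ hpos.ne')
  · filter_upwards [ae_restrict_mem measurableSet_Ioi] with y hy
    have : (0 : ℝ) < y := hy
    positivity

/-- A Beta integral over the half line, obtained by writing `(x + h) ^ (α - 1)` as a Laplace
transform and exchanging the integrals. -/
theorem lintegral_rpow_mul_add_rpow {α h : ℝ} (hα : 0 < α) (hα2 : α < 1 / 2) (hh : 0 < h) :
    ∫⁻ x in Set.Ioi (0 : ℝ), ENNReal.ofReal (x ^ (α - 1)) * ENNReal.ofReal ((x + h) ^ (α - 1)) =
      ENNReal.ofReal (Gamma α * Gamma (1 - 2 * α) / Gamma (1 - α) * h ^ (2 * α - 1)) := by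
  have hG : 0 < Gamma (1 - α) := Gamma_pos_of_pos (by linarith)
  have hGα : 0 < Gamma α := Gamma_pos_of_pos hα
  have key : ∀ x ∈ Set.Ioi (0 : ℝ),
      ENNReal.ofReal (x ^ (α - 1)) * ENNReal.ofReal ((x + h) ^ (α - 1)) =
      ∫⁻ y in Set.Ioi (0 : ℝ), ENNReal.ofReal (1 / Gamma (1 - α) * y ^ (-α) * exp (-(h * y))) *
        ENNReal.ofReal (x ^ (α - 1) * exp (-(y * x))) := by
    intro x hx
    have hx : (0 : ℝ) < x := hx
    have h1 := lintegral_rpow_mul_exp_neg_mul (a := 1 - α) (b := x + h) (by linarith)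
      (by linarith)
    have h2 : (x + h) ^ (α - 1) =
        1 / Gamma (1 - α) * ((1 / (x + h)) ^ (1 - α) * Gamma (1 - α)) := by
      rw [one_div (x + h), inv_rpow (by positivity), ← rpow_neg (by positivity)]
      field_simp
      ring_nf
    rw [← ENNReal.ofReal_mul (by positivity), h2, ← mul_assoc,
      ENNReal.ofReal_mul (by positivity), ← h1, ← lintegral_const_mul _ (by fun_prop)]
    refine setLIntegral_congr_fun measurableSet_Ioi fun y hy => ?_
    have hy : (0 : ℝ) < y := hy
    rw [← ENNReal.ofReal_mul (by positivity), ← ENNReal.ofReal_mul (by positivity)]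
    congr 1
    rw [show -((x + h) * y) = -(h * y) + -(y * x) by ring, exp_add,
      show 1 - α - 1 = -α by ring]
    ring
  rw [setLIntegral_congr_fun measurableSet_Ioi key, lintegral_lintegral_swap (by fun_prop)]
  have key2 : ∀ y ∈ Set.Ioi (0 : ℝ),
      ∫⁻ x in Set.Ioi (0 : ℝ), ENNReal.ofReal (1 / Gamma (1 - α) * y ^ (-α) * exp (-(h * y))) *
        ENNReal.ofReal (x ^ (α - 1) * exp (-(y * x))) =
      ENNReal.ofReal (Gamma α / Gamma (1 - α)) *
        ENNReal.ofReal (y ^ (1 - 2 * α - 1) * exp (-(h * y))) := by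
    intro y hy
    have hy : (0 : ℝ) < y := hy
    rw [lintegral_const_mul _ (by fun_prop), lintegral_rpow_mul_exp_neg_mul hα hy,
      ← ENNReal.ofReal_mul (by positivity), ← ENNReal.ofReal_mul (by positivity)]
    congr 1
    rw [one_div y, inv_rpow hy.le, ← rpow_neg hy.le,
      show 1 - 2 * α - 1 = -α + -α by ring, rpow_add hy]
    ring
  rw [setLIntegral_congr_fun measurableSet_Ioi key2, lintegral_const_mul _ (by fun_prop),
    lintegral_rpow_mul_exp_neg_mul (by linarith) hh, ← ENNReal.ofReal_mul (by positivity)]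
  congr 1
  rw [one_div h, inv_rpow hh.le, ← rpow_neg hh.le, show -(1 - 2 * α) = 2 * α - 1 by ring]
  ring

theorem lintegral_max_rpow_mul_max_rpow_of_lt {α r v : ℝ} (hα : 0 < α) (hα2 : α < 1 / 2)
    (hrv : r < v) :
    ∫⁻ s : ℝ, ENNReal.ofReal (max (r - s) 0 ^ (α - 1)) *
        ENNReal.ofReal (max (v - s) 0 ^ (α - 1)) =
      ENNReal.ofReal (Gamma α * Gamma (1 - 2 * α) / Gamma (1 - α) * |r - v| ^ (2 * α - 1)) := by
  rw [abs_sub_comm, abs_of_pos (sub_pos.2 hrv),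
    ← lintegral_rpow_mul_add_rpow hα hα2 (sub_pos.2 hrv),
    ← lintegral_indicator measurableSet_Ioi,
    ← lintegral_sub_left_eq_self (Set.indicator (Set.Ioi 0) _) r]
  refine lintegral_congr fun s => ?_
  by_cases hs : r - s ∈ Set.Ioi (0 : ℝ)
  · have hs' : 0 < r - s := hs
    rw [Set.indicator_of_mem hs, max_eq_left hs'.le, max_eq_left (by linarith),
      show r - s + (v - r) = v - s by ring]
  · rw [Set.indicator_of_notMem hs, max_eq_right (not_lt.1 hs), zero_rpow (by linarith)]
    simp

theorem lintegral_max_rpow_mul_max_rpow {α r v : ℝ} (hα : 0 < α) (hα2 : α < 1 / 2)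
    (hrv : r ≠ v) :
    ∫⁻ s : ℝ, ENNReal.ofReal (max (r - s) 0 ^ (α - 1)) *
        ENNReal.ofReal (max (v - s) 0 ^ (α - 1)) =
      ENNReal.ofReal (Gamma α * Gamma (1 - 2 * α) / Gamma (1 - α) * |r - v| ^ (2 * α - 1)) := by
  rcases lt_or_gt_of_ne hrv with h | h
  · exact lintegral_max_rpow_mul_max_rpow_of_lt hα hα2 h
  · rw [abs_sub_comm, ← lintegral_max_rpow_mul_max_rpow_of_lt hα hα2 h]
    simp_rw [mul_comm]

theorem lintegral_Ioc_abs_sub_rpow {p t r : ℝ} (hp : 0 < p) (hp1 : p ≠ 1)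
    (hr : r ∈ Set.Ioc 0 t) :
    ∫⁻ v in Set.Ioc 0 t, ENNReal.ofReal (|r - v| ^ (p - 1)) =
      ENNReal.ofReal (1 / p) * (ENNReal.ofReal (max (r - 0) 0 ^ (p + 1 - 1)) +
        ENNReal.ofReal (max (t - r) 0 ^ (p + 1 - 1))) := by
  have h0t : (0 : ℝ) ≤ t := hr.1.le.trans hr.2
  have key : ∀ v, ENNReal.ofReal (|r - v| ^ (p - 1)) =
      ENNReal.ofReal (max (r - v) 0 ^ (p - 1)) + ENNReal.ofReal (max (v - r) 0 ^ (p - 1)) := by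
    intro v
    have h0 : (0 : ℝ) ^ (p - 1) = 0 := zero_rpow (sub_ne_zero.2 hp1)
    rcases le_total r v with h | h
    · rw [max_eq_right (sub_nonpos.2 h), max_eq_left (sub_nonneg.2 h), h0, abs_sub_comm,
        abs_of_nonneg (sub_nonneg.2 h)]
      simp
    · rw [max_eq_right (sub_nonpos.2 h), max_eq_left (sub_nonneg.2 h), h0,
        abs_of_nonneg (sub_nonneg.2 h)]
      simp
  simp_rw [key]
  rw [lintegral_add_left (by fun_prop), lintegral_Ioc_max_const_sub_rpow hp hp1 h0t,
    lintegral_Ioc_max_sub_rpow hp hp1 h0t, max_eq_right (sub_nonpos.2 hr.2),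
    max_eq_right (by linarith [hr.1] : 0 - r ≤ 0), zero_rpow hp.ne', mul_add,
    ← ENNReal.ofReal_mul (by positivity), ← ENNReal.ofReal_mul (by positivity),
    add_sub_cancel_right]
  congr 2 <;> ring

theorem lintegral_lintegral_Ioc_abs_sub_rpow {p t : ℝ} (hp : 0 < p) (hp1 : p ≠ 1)
    (ht : 0 ≤ t) :
    ∫⁻ r in Set.Ioc 0 t, ∫⁻ v in Set.Ioc 0 t, ENNReal.ofReal (|r - v| ^ (p - 1)) =
      ENNReal.ofReal (2 / (p * (p + 1)) * t ^ (p + 1)) := by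
  have hp' : p + 1 ≠ 1 := by linarith
  rw [setLIntegral_congr_fun measurableSet_Ioc fun r hr => lintegral_Ioc_abs_sub_rpow hp hp1 hr,
    lintegral_const_mul _ (by fun_prop), lintegral_add_left (by fun_prop),
    lintegral_Ioc_max_const_sub_rpow (by linarith) hp' ht,
    lintegral_Ioc_max_sub_rpow (by linarith) hp' ht]
  simp only [sub_zero, sub_self, max_self, max_eq_left ht, zero_rpow (by linarith : p + 1 ≠ 0)]
  rw [← ENNReal.ofReal_add (by positivity) (by positivity), ← ENNReal.ofReal_mul (by positivity)]
  congr 1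
  field_simp
  ring

theorem lintegral_sq_movingAverage_kernel {α t : ℝ} (hα : 0 < α) (hα2 : α < 1 / 2)
    (ht : 0 ≤ t) :
    ∫⁻ s : ℝ, ENNReal.ofReal ((max (t - s) 0 ^ α - max (-s) 0 ^ α) ^ 2) =
      ENNReal.ofReal (α * (Gamma α * Gamma (1 - 2 * α) / Gamma (1 - α)) / (2 * α + 1) *
        t ^ (2 * α + 1)) := by
  have hK : 0 ≤ Gamma α * Gamma (1 - 2 * α) / Gamma (1 - α) := by
    have := Gamma_pos_of_pos hα
    have := Gamma_pos_of_pos (by linarith : 0 < 1 - α)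
    have := Gamma_pos_of_pos (by linarith : 0 < 1 - 2 * α)
    positivity
  have key : ∀ s : ℝ, ENNReal.ofReal ((max (t - s) 0 ^ α - max (-s) 0 ^ α) ^ 2) =
      ENNReal.ofReal (α ^ 2) * ∫⁻ r in Set.Ioc 0 t, ∫⁻ v in Set.Ioc 0 t,
        ENNReal.ofReal (max (r - s) 0 ^ (α - 1)) * ENNReal.ofReal (max (v - s) 0 ^ (α - 1)) := by
    intro s
    have hmono : max (-s) 0 ^ α ≤ max (t - s) 0 ^ α :=
      rpow_le_rpow (le_max_right _ _) (max_le_max_right 0 (by linarith)) hα.le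
    rw [lintegral_congr fun r => lintegral_const_mul _ (by fun_prop),
      lintegral_mul_const _ (by fun_prop), lintegral_Ioc_max_sub_rpow hα (by linarith) ht,
      zero_sub, ← ENNReal.ofReal_mul (div_nonneg (sub_nonneg.2 hmono) hα.le),
      ← ENNReal.ofReal_mul (by positivity)]
    congr 1
    field_simp
  rw [lintegral_congr key, lintegral_const_mul _ (by fun_prop),
    lintegral_lintegral_swap (by fun_prop)]
  have inner : ∀ r : ℝ, ∫⁻ s : ℝ, ∫⁻ v in Set.Ioc 0 t,
        ENNReal.ofReal (max (r - s) 0 ^ (α - 1)) * ENNReal.ofReal (max (v - s) 0 ^ (α - 1)) =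
      ENNReal.ofReal (Gamma α * Gamma (1 - 2 * α) / Gamma (1 - α)) *
        ∫⁻ v in Set.Ioc 0 t, ENNReal.ofReal (|r - v| ^ (2 * α - 1)) := by
    intro r
    rw [lintegral_lintegral_swap (by fun_prop), ← lintegral_const_mul _ (by fun_prop)]
    refine lintegral_congr_ae ?_
    filter_upwards [ae_restrict_of_ae (Measure.ae_ne volume r)] with v hv
    rw [lintegral_max_rpow_mul_max_rpow hα hα2 hv.symm, ENNReal.ofReal_mul hK]
  rw [lintegral_congr inner, lintegral_const_mul _ (by fun_prop),
    lintegral_lintegral_Ioc_abs_sub_rpow (by linarith) (by linarith) ht,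
    ← ENNReal.ofReal_mul hK, ← ENNReal.ofReal_mul (by positivity)]
  congr 1
  field_simp

theorem movingAverage_const_eq {H : ℝ} (h1 : 1 / 2 < H) (h2 : H < 1) :
    (H - 1 / 2) * (Gamma (H - 1 / 2) * Gamma (1 - 2 * (H - 1 / 2)) / Gamma (1 - (H - 1 / 2))) /
        (2 * (H - 1 / 2) + 1) =
      Gamma (H + 1 / 2) ^ 2 / (2 * H * sin (π * H) * Gamma (2 * H)) := by
  obtain ⟨α, rfl⟩ : ∃ α, H = α + 1 / 2 := ⟨H - 1 / 2, by ring⟩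
  have hα : 0 < α := by linarith
  have hα2 : α < 1 / 2 := by linarith
  have e1 : sin (π * (α + 1 / 2)) = cos (π * α) := by
    rw [← sin_add_pi_div_two]; ring_nf
  have e2 : Gamma (2 * (α + 1 / 2)) = 2 * α * Gamma (2 * α) := by
    rw [← Gamma_add_one (by positivity)]; ring_nf
  have e3 : Gamma (α + 1 / 2 + 1 / 2) = α * Gamma α := by
    rw [← Gamma_add_one hα.ne']; ring_nf
  have r1 := Gamma_mul_Gamma_one_sub α
  have r2 := Gamma_mul_Gamma_one_sub (2 * α)
  rw [show π * (2 * α) = 2 * (π * α) by ring, sin_two_mul] at r2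
  have hs : 0 < sin (π * α) := sin_pos_of_pos_of_lt_pi (by positivity) (by nlinarith [pi_pos])
  have hc : 0 < cos (π * α) :=
    cos_pos_of_mem_Ioo ⟨by nlinarith [pi_pos], by nlinarith [pi_pos]⟩
  have g1 := Gamma_pos_of_pos hα
  have g2 := Gamma_pos_of_pos (by linarith : 0 < 1 - α)
  have g3 := Gamma_pos_of_pos (by linarith : 0 < 2 * α)
  rw [e1, e2, e3, add_sub_cancel_right]
  have r : Gamma (2 * α) * Gamma (1 - 2 * α) * (2 * cos (π * α)) =
      Gamma α * Gamma (1 - α) := by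
    rw [r1, r2]; field_simp
  rw [← mul_div_assoc, div_div, div_eq_div_iff (by positivity) (by positivity)]
  linear_combination α ^ 2 * Gamma α * (2 * α + 1) * r

theorem integrable_sq_movingAverage_kernel_and_integral {H : ℝ} (h1 : 1 / 2 < H) (h2 : H < 1)
    (t : ℝ) :
    Integrable (fun s : ℝ => (max (t - s) 0 ^ (H - 1 / 2) - max (-s) 0 ^ (H - 1 / 2)) ^ 2) ∧
    ∫ s : ℝ, (max (t - s) 0 ^ (H - 1 / 2) - max (-s) 0 ^ (H - 1 / 2)) ^ 2 =
      Gamma (H + 1 / 2) ^ 2 / (2 * H * sin (π * H) * Gamma (2 * H)) * |t| ^ (2 * H) := by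
  have of_nonneg : ∀ t : ℝ, 0 ≤ t →
      Integrable (fun s : ℝ => (max (t - s) 0 ^ (H - 1 / 2) - max (-s) 0 ^ (H - 1 / 2)) ^ 2) ∧
      ∫ s : ℝ, (max (t - s) 0 ^ (H - 1 / 2) - max (-s) 0 ^ (H - 1 / 2)) ^ 2 =
        Gamma (H + 1 / 2) ^ 2 / (2 * H * sin (π * H) * Gamma (2 * H)) * |t| ^ (2 * H) := by
    intro t ht
    have h := lintegral_sq_movingAverage_kernel (α := H - 1 / 2) (by linarith) (by linarith) ht
    rw [movingAverage_const_eq h1 h2, show 2 * (H - 1 / 2) + 1 = 2 * H by ring] at h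
    have hs : 0 < sin (π * H) :=
      sin_pos_of_pos_of_lt_pi (mul_pos pi_pos (by linarith)) (by nlinarith [pi_pos])
    have hG := Gamma_pos_of_pos (by linarith : 0 < 2 * H)
    have hH : 0 < H := by linarith
    have hm : Measurable fun s : ℝ =>
        (max (t - s) 0 ^ (H - 1 / 2) - max (-s) 0 ^ (H - 1 / 2)) ^ 2 := by fun_prop
    have hnn := Filter.Eventually.of_forall (f := ae volume)
      fun s : ℝ => sq_nonneg (max (t - s) 0 ^ (H - 1 / 2) - max (-s) 0 ^ (H - 1 / 2))
    refine ⟨(lintegral_ofReal_ne_top_iff_integrable hm.aestronglyMeasurable hnn).1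
      (h ▸ ENNReal.ofReal_ne_top), ?_⟩
    rw [integral_eq_lintegral_of_nonneg_ae hnn hm.aestronglyMeasurable, h, abs_of_nonneg ht,
      ENNReal.toReal_ofReal (by positivity)]
  rcases le_total 0 t with ht | ht
  · exact of_nonneg t ht
  · obtain ⟨hi, hv⟩ := of_nonneg (-t) (neg_nonneg.2 ht)
    have e : (fun s : ℝ => (max (t - s) 0 ^ (H - 1 / 2) - max (-s) 0 ^ (H - 1 / 2)) ^ 2) =
        fun s => (max (-t - (s - t)) 0 ^ (H - 1 / 2) - max (-(s - t)) 0 ^ (H - 1 / 2)) ^ 2 := by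
      funext s
      rw [show -t - (s - t) = -s by ring, neg_sub]
      ring
    rw [e]
    refine ⟨hi.comp_sub_right t, ?_⟩
    rw [integral_sub_right_eq_self
      (fun s : ℝ => (max (-t - s) 0 ^ (H - 1 / 2) - max (-s) 0 ^ (H - 1 / 2)) ^ 2) t, hv, abs_neg]

/-- Moving-average covariance identity for fractional Brownian motion: for `H ∈ (1/2,1)` and
`t, u ∈ ℝ`,
`∫_ℝ ((t−s)₊^{H−1/2} − (−s)₊^{H−1/2}) ((u−s)₊^{H−1/2} − (−s)₊^{H−1/2}) ds
  = (Γ(H+1/2)² / (2H sin(πH) Γ(2H))) · (1/2)(|t|^{2H} + |u|^{2H} − |t−u|^{2H})`. -/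
theorem fBm_moving_average_covariance_integral
    (H : ℝ) (hH : H ∈ Set.Ioo (1 / 2 : ℝ) 1) (t u : ℝ) :
    (∫ s : ℝ,
        (max (t - s) 0 ^ (H - 1 / 2) - max (-s) 0 ^ (H - 1 / 2)) *
          (max (u - s) 0 ^ (H - 1 / 2) - max (-s) 0 ^ (H - 1 / 2))) =
      Real.Gamma (H + 1 / 2) ^ 2 / (2 * H * Real.sin (π * H) * Real.Gamma (2 * H)) *
        (1 / 2 * (|t| ^ (2 * H) + |u| ^ (2 * H) - |t - u| ^ (2 * H))) := by
  obtain ⟨h1, h2⟩ := hH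
  obtain ⟨hit, hvt⟩ := integrable_sq_movingAverage_kernel_and_integral h1 h2 t
  obtain ⟨hiu, hvu⟩ := integrable_sq_movingAverage_kernel_and_integral h1 h2 u
  obtain ⟨hid, hvd⟩ := integrable_sq_movingAverage_kernel_and_integral h1 h2 (t - u)
  have hid' := hid.comp_sub_right u
  rw [← integral_sub_right_eq_self _ u] at hvd
  rw [← mul_assoc, mul_comm _ (1 / 2 : ℝ), mul_assoc, mul_sub, mul_add, ← hvt, ← hvu, ← hvd,
    ← integral_add hit hiu]
  refine Eq.trans ?_ (congrArg _ (integral_sub (hit.add hiu) hid'))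
  rw [← integral_const_mul]
  refine integral_congr_ae (Filter.Eventually.of_forall fun s => ?_)
  dsimp only
  rw [show t - u - (s - u) = t - s by ring, neg_sub]
  ring
end

section
/- Let H ∈ (0, 1). Then the fractional Brownian motion covariance kernel R(t, s) = (1/2)(|t|^{2H} + |s|^{2H} − |t−s|^{2H}) is positive semidefinite on ℝ: for every n ∈ ℕ, all t₁, …, t_n ∈ ℝ, and all c₁, …, c_n ∈ ℝ, ∑_{i=1}^{n} ∑_{j=1}^{n} c_i c_j (|t_i|^{2H} + |t_j|^{2H} − |t_i − t_j|^{2H}) ≥ 0. -/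
open MeasureTheory Set

lemma integrableOn_one_sub_cos_mul_rpow {H : ℝ} (hH : H ∈ Ioo (0 : ℝ) 1) (x : ℝ) :
    IntegrableOn (fun s : ℝ => (1 - Real.cos (x * s)) * s ^ (-2 * H - 1)) (Ioi 0) := by
  obtain ⟨h0, h1⟩ := hH
  have hmeas : Measurable (fun s : ℝ => (1 - Real.cos (x * s)) * s ^ (-2 * H - 1)) := by
    fun_prop
  rw [← Ioc_union_Ioi_eq_Ioi (zero_le_one' ℝ)]
  refine IntegrableOn.union ?_ ?_
  · have hint : IntegrableOn (fun s : ℝ => x ^ 2 / 2 * s ^ (1 - 2 * H)) (Ioc 0 1) := by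
      have h := intervalIntegral.intervalIntegrable_rpow' (a := 0) (b := 1)
        (show -1 < 1 - 2 * H by linarith)
      exact ((intervalIntegrable_iff_integrableOn_Ioc_of_le zero_le_one).1 h).const_mul _
    refine Integrable.mono' hint hmeas.aestronglyMeasurable ?_
    filter_upwards [ae_restrict_mem measurableSet_Ioc] with s hs
    have hs0 : 0 < s := hs.1
    have hp : 0 ≤ s ^ (-2 * H - 1) := Real.rpow_nonneg hs0.le _
    have hc : 0 ≤ 1 - Real.cos (x * s) := by linarith [Real.cos_le_one (x * s)]
    rw [Real.norm_of_nonneg (mul_nonneg hc hp)]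
    have hpow : s ^ (1 - 2 * H) = s ^ 2 * s ^ (-2 * H - 1) := by
      rw [← Real.rpow_natCast s 2, ← Real.rpow_add hs0]
      congr 1
      push_cast
      ring
    calc (1 - Real.cos (x * s)) * s ^ (-2 * H - 1)
        ≤ (x * s) ^ 2 / 2 * s ^ (-2 * H - 1) := by
          gcongr
          linarith [Real.one_sub_sq_div_two_le_cos (x := x * s)]
      _ = x ^ 2 / 2 * s ^ (1 - 2 * H) := by rw [hpow]; ring
  · have hint : IntegrableOn (fun s : ℝ => 2 * s ^ (-2 * H - 1)) (Ioi 1) :=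
      (integrableOn_Ioi_rpow_of_lt (by linarith) one_pos).const_mul _
    refine Integrable.mono' hint hmeas.aestronglyMeasurable ?_
    filter_upwards [ae_restrict_mem measurableSet_Ioi] with s hs
    have hs0 : 0 < s := one_pos.trans hs
    have hp : 0 ≤ s ^ (-2 * H - 1) := Real.rpow_nonneg hs0.le _
    have hc : 0 ≤ 1 - Real.cos (x * s) := by linarith [Real.cos_le_one (x * s)]
    rw [Real.norm_of_nonneg (mul_nonneg hc hp)]
    gcongr
    linarith [Real.neg_one_le_cos (x * s)]

lemma integral_one_sub_cos_mul_rpow {H : ℝ} (hH : H ∈ Ioo (0 : ℝ) 1) (x : ℝ) :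
    ∫ s in Ioi (0 : ℝ), (1 - Real.cos (x * s)) * s ^ (-2 * H - 1) =
      |x| ^ (2 * H) * ∫ s in Ioi (0 : ℝ), (1 - Real.cos s) * s ^ (-2 * H - 1) := by
  rcases eq_or_ne x 0 with rfl | hx
  · have h2 : 2 * H ≠ 0 := by linarith [hH.1]
    simp [Real.zero_rpow h2]
  have hx0 : 0 < |x| := abs_pos.2 hx
  have hscale := integral_comp_mul_left_Ioi
    (fun s : ℝ => (1 - Real.cos s) * s ^ (-2 * H - 1)) 0 hx0
  rw [mul_zero, smul_eq_mul] at hscale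
  have hpow : |x| ^ (2 * H) * |x|⁻¹⁻¹ * |x| ^ (-2 * H - 1) = 1 := by
    rw [inv_inv, ← Real.rpow_add_one hx0.ne', ← Real.rpow_add hx0]
    ring_nf
    simp
  rw [← inv_mul_eq_iff_eq_mul₀ (inv_ne_zero hx0.ne')] at hscale
  rw [← hscale, ← mul_assoc, ← integral_const_mul]
  refine setIntegral_congr_fun measurableSet_Ioi fun s hs => ?_
  have hcos : Real.cos (|x| * s) = Real.cos (x * s) := by
    rw [← abs_of_pos (show 0 < s from hs), ← abs_mul, Real.cos_abs]
    rcases abs_cases x with ⟨h, -⟩ | ⟨h, -⟩ <;> simp [abs_of_pos (show 0 < s from hs)]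
  simp only [hcos, Real.mul_rpow hx0.le (le_of_lt hs)]
  linear_combination (-(1 - Real.cos (x * s)) * s ^ (-2 * H - 1)) * hpow

lemma integral_one_sub_cos_mul_rpow_pos {H : ℝ} (hH : H ∈ Ioo (0 : ℝ) 1) :
    0 < ∫ s in Ioi (0 : ℝ), (1 - Real.cos s) * s ^ (-2 * H - 1) := by
  have hint : IntegrableOn (fun s : ℝ => (1 - Real.cos s) * s ^ (-2 * H - 1)) (Ioi 0) := by
    simpa using integrableOn_one_sub_cos_mul_rpow hH 1
  rw [setIntegral_pos_iff_support_of_nonneg_ae _ hint]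
  · refine lt_of_lt_of_le (b := volume (Ioo (0 : ℝ) 1)) (by simp) (measure_mono fun s hs => ?_)
    refine ⟨mul_ne_zero ?_ (Real.rpow_pos_of_pos hs.1 _).ne', hs.1⟩
    have hlt : Real.cos s < Real.cos 0 :=
      Real.cos_lt_cos_of_nonneg_of_le_pi le_rfl (by linarith [hs.2, Real.pi_gt_three]) hs.1
    rw [Real.cos_zero] at hlt
    exact (sub_pos.2 hlt).ne'
  · filter_upwards [ae_restrict_mem measurableSet_Ioi] with s hs
    exact mul_nonneg (by linarith [Real.cos_le_one s]) (Real.rpow_nonneg (le_of_lt hs) _)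

lemma sum_mul_one_sub_cos_nonneg {ι : Type*} [Fintype ι] (t c : ι → ℝ) (s : ℝ) :
    0 ≤ ∑ i, ∑ j, c i * c j * ((1 - Real.cos (t i * s)) + (1 - Real.cos (t j * s)) -
      (1 - Real.cos ((t i - t j) * s))) := by
  have h : ∑ i, ∑ j, c i * c j * ((1 - Real.cos (t i * s)) + (1 - Real.cos (t j * s)) -
      (1 - Real.cos ((t i - t j) * s))) =
      (∑ i, c i * (1 - Real.cos (t i * s))) ^ 2 + (∑ i, c i * Real.sin (t i * s)) ^ 2 := by
    simp only [sq, Finset.sum_mul_sum, ← Finset.sum_add_distrib]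
    refine Finset.sum_congr rfl fun i _ => Finset.sum_congr rfl fun j _ => ?_
    rw [sub_mul, Real.cos_sub]
    ring
  rw [h]
  positivity

/-- The fractional Brownian motion covariance kernel
`R(t,s) = (1/2)(|t|^{2H} + |s|^{2H} − |t−s|^{2H})` is positive semidefinite on `ℝ` for every
`H ∈ (0,1)`:
`∑ i ∑ j c i * c j * (|t i|^{2H} + |t j|^{2H} − |t i − t j|^{2H}) ≥ 0`. -/
theorem fBm_covariance_posSemidef
    (H : ℝ) (hH : H ∈ Set.Ioo (0 : ℝ) 1) (n : ℕ) (t c : Fin n → ℝ) :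
    0 ≤ ∑ i : Fin n, ∑ j : Fin n,
        c i * c j * (|t i| ^ (2 * H) + |t j| ^ (2 * H) - |t i - t j| ^ (2 * H)) := by
  set K : ℝ := ∫ s in Ioi (0 : ℝ), (1 - Real.cos s) * s ^ (-2 * H - 1) with hK
  have hKpos : 0 < K := integral_one_sub_cos_mul_rpow_pos hH
  have hI := integrableOn_one_sub_cos_mul_rpow hH
  have hterm (i j : Fin n) : IntegrableOn (fun s : ℝ => c i * c j *
      ((1 - Real.cos (t i * s)) * s ^ (-2 * H - 1) + (1 - Real.cos (t j * s)) * s ^ (-2 * H - 1) -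
        (1 - Real.cos ((t i - t j) * s)) * s ^ (-2 * H - 1))) (Ioi 0) :=
    (((hI (t i)).add (hI (t j))).sub (hI (t i - t j))).const_mul _
  have heq : (∑ i : Fin n, ∑ j : Fin n,
        c i * c j * (|t i| ^ (2 * H) + |t j| ^ (2 * H) - |t i - t j| ^ (2 * H))) * K =
      ∫ s in Ioi (0 : ℝ), ∑ i : Fin n, ∑ j : Fin n, c i * c j *
        ((1 - Real.cos (t i * s)) * s ^ (-2 * H - 1) + (1 - Real.cos (t j * s)) * s ^ (-2 * H - 1) -
          (1 - Real.cos ((t i - t j) * s)) * s ^ (-2 * H - 1)) := by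
    rw [integral_finsetSum _ fun i _ => integrable_finsetSum _ fun j _ => hterm i j,
      Finset.sum_mul]
    refine Finset.sum_congr rfl fun i _ => ?_
    rw [integral_finsetSum _ fun j _ => hterm i j, Finset.sum_mul]
    refine Finset.sum_congr rfl fun j _ => ?_
    rw [integral_const_mul, integral_sub (by exact (hI (t i)).add (hI (t j))) (hI (t i - t j)),
      integral_add (hI (t i)) (hI (t j))]
    simp only [integral_one_sub_cos_mul_rpow hH, ← hK]
    ring
  refine nonneg_of_mul_nonneg_left (b := K) ?_ hKpos
  rw [heq]
  refine setIntegral_nonneg measurableSet_Ioi fun s hs => ?_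
  have hfactor := mul_nonneg (sum_mul_one_sub_cos_nonneg t c s)
    (Real.rpow_nonneg (le_of_lt hs) (-2 * H - 1))
  simp only [Finset.sum_mul] at hfactor
  refine hfactor.trans_eq (Finset.sum_congr rfl fun i _ => Finset.sum_congr rfl fun j _ => ?_)
  ring
end
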